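/- Let B be a Boolean contact algebra, let Grz(B) be the set of G-points of B, and equip Grz(B) with the topology generated by the sets G(x) = {𝒢 ∈ Grz(B) : x ∈ 𝒢} for x ∈ B. Then Grz(B) is a T1 topological space. -/

import Mathlib

variable {B : Type*} [BooleanAlgebra B]

/-- A Boolean contact algebra structure on a Boolean algebra `B`. -/
structure BCA (B : Type*) [BooleanAlgebra B] where
  C : B → B → Prop
  c0 : ∀ x : B, ¬ C ⊥ x
  c1 : ∀ x y : B, x ≠ ⊥ → x ≤ y → C x y
  c2 : ∀ x y : B, C x y → C y x
  c3 : ∀ x y z : B, x ≤ y → C z x → C z y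
  c4 : ∀ x y z : B, C x (y ⊔ z) → C x y ∨ C x z

namespace BCA

/-- The well-inside relation: `x ≪ y` iff `¬ (x C yᶜ)`. -/
def wi (A : BCA B) (x y : B) : Prop := ¬ A.C x yᶜ

/-- `Q₁` covers `Q₂` iff every element of `Q₁` contains some element of `Q₂`. -/
def Covers (Q₁ Q₂ : Set B) : Prop := ∀ x ∈ Q₁, ∃ y ∈ Q₂, y ≤ x

/-- A Grzegorczyk representative of a point. -/
def IsGRep (A : BCA B) (Q : Set B) : Prop :=
  Q.Nonempty ∧ (⊥ : B) ∉ Q ∧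
    (∀ u ∈ Q, ∀ v ∈ Q, u = v ∨ A.wi u v ∨ A.wi v u) ∧
    (∀ u ∈ Q, ∃ v ∈ Q, A.wi v u) ∧
    (∀ x y : B, (∀ u ∈ Q, u ⊓ x ≠ ⊥ ∧ u ⊓ y ≠ ⊥) → A.C x y)

/-- An abstractive set. -/
def IsAbstractive (A : BCA B) (S : Set B) : Prop :=
  S.Nonempty ∧ (⊥ : B) ∉ S ∧
    (∀ u ∈ S, ∀ v ∈ S, u = v ∨ A.wi u v ∨ A.wi v u) ∧
    ¬ ∃ x ∈ S, ∀ y ∈ S, x ≤ y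

/-- A Whitehead representative of a point. -/
def IsWRep (A : BCA B) (S : Set B) : Prop :=
  A.IsAbstractive S ∧ ∀ T : Set B, A.IsAbstractive T → Covers S T → Covers T S

/-- An ω-abstractive set: an abstractive set mutually covering with a countable abstractive set. -/
def IsOmegaAbstractive (A : BCA B) (S : Set B) : Prop :=
  A.IsAbstractive S ∧
    ∃ T : Set B, T.Countable ∧ A.IsAbstractive T ∧ Covers S T ∧ Covers T S

/-- A filter of the Boolean algebra `B`. -/
def IsFilter (F : Set B) : Prop :=
  F.Nonempty ∧ (⊥ : B) ∉ F ∧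
    (∀ x ∈ F, ∀ y : B, x ≤ y → y ∈ F) ∧
    (∀ x ∈ F, ∀ y ∈ F, x ⊓ y ∈ F)

/-- A round filter. -/
def IsRoundFilter (A : BCA B) (F : Set B) : Prop :=
  IsFilter F ∧ ∀ x ∈ F, ∃ y ∈ F, A.wi y x

/-- A Grzegorczyk point: the filter generated by a G-representative. -/
def IsGPoint (A : BCA B) (G : Set B) : Prop :=
  ∃ Q : Set B, A.IsGRep Q ∧ G = {y : B | ∃ x ∈ Q, x ≤ y}

/-- Atomlessness of the Boolean algebra. -/
def Atomless (B : Type*) [BooleanAlgebra B] : Prop :=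
  ∀ x : B, x ≠ ⊥ → ∃ y : B, y ≠ ⊥ ∧ y < x

/-- The interpolation axiom (DV6). -/
def DV6 (A : BCA B) : Prop := ∀ x y : B, A.wi x y → ∃ z : B, A.wi x z ∧ A.wi z y

/-- The non-tangential part axiom (DV7). -/
def DV7 (A : BCA B) : Prop := ∀ x : B, x ≠ ⊥ → ∃ y : B, y ≠ ⊥ ∧ A.wi y x

/-- The connectedness axiom (C5). -/
def C5 (A : BCA B) : Prop := ∀ x : B, x ≠ ⊥ → x ≠ ⊤ → A.C x xᶜ

/-- The countable chain condition for a Boolean algebra. -/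
def CCC (B : Type*) [BooleanAlgebra B] : Prop :=
  ∀ S : Set B, (∀ x ∈ S, x ≠ ⊥) → (S.Pairwise fun x y => x ⊓ y = ⊥) → S.Countable

end BCA

/-- The set of Grzegorczyk points of a Boolean contact algebra. -/
def BCA.Grz {B : Type*} [BooleanAlgebra B] (A : BCA B) : Set (Set B) :=
  {G | A.IsGPoint G}

namespace BCA

theorem wi.le {B : Type*} [BooleanAlgebra B] {A : BCA B} {x y : B} (h : A.wi x y) : x ≤ y := by
  by_contra hxy
  have hne : x ⊓ yᶜ ≠ ⊥ := fun h0 => hxy (by rwa [← disjoint_compl_right_iff, disjoint_iff])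
  have hC : A.C yᶜ x :=
    A.c3 _ _ _ inf_le_left (A.c2 _ _ (A.c1 _ _ hne inf_le_right))
  exact h (A.c2 _ _ hC)

theorem wi.mono_right {B : Type*} [BooleanAlgebra B] {A : BCA B} {x y z : B} (h : A.wi x y)
    (hyz : y ≤ z) : A.wi x z :=
  fun hC => h (A.c3 _ _ _ (compl_le_compl hyz) hC)

theorem IsGRep.inf_ne_bot {B : Type*} [BooleanAlgebra B] {A : BCA B} {Q : Set B}
    (hQ : A.IsGRep Q) {u v : B} (hu : u ∈ Q) (hv : v ∈ Q) : u ⊓ v ≠ ⊥ := by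
  obtain ⟨-, hbot, hcomp, -, -⟩ := hQ
  rcases hcomp u hu v hv with rfl | h | h
  · rw [inf_idem]
    exact fun h0 => hbot (h0 ▸ hu)
  · rw [inf_eq_left.2 h.le]
    exact fun h0 => hbot (h0 ▸ hu)
  · rw [inf_eq_right.2 h.le]
    exact fun h0 => hbot (h0 ▸ hv)

/-- Distinct Grzegorczyk points are incomparable with respect to inclusion. -/
theorem IsGPoint.eq_of_subset {B : Type*} [BooleanAlgebra B] {A : BCA B} {G H : Set B}
    (hG : A.IsGPoint G) (hH : A.IsGPoint H) (h : G ⊆ H) : G = H := by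
  obtain ⟨P, hP, rfl⟩ := hG
  obtain ⟨Q, hQ, rfl⟩ := hH
  refine h.antisymm ?_
  rintro x ⟨q, hq, hqx⟩
  obtain ⟨v, hv, hvq⟩ := hQ.2.2.2.1 q hq
  by_contra hx
  refine (hvq.mono_right hqx) (hP.2.2.2.2 v xᶜ fun u hu => ⟨fun h0 => ?_, fun h0 => ?_⟩)
  · obtain ⟨w, hw, hwu⟩ := h ⟨u, hu, le_rfl⟩
    exact hQ.inf_ne_bot hw hv (le_bot_iff.1 ((inf_le_inf_right v hwu).trans h0.le))
  · exact hx ⟨u, hu, disjoint_compl_right_iff.1 (disjoint_iff.2 h0)⟩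

end BCA

theorem stmt_18 {B : Type*} [BooleanAlgebra B] (A : BCA B) :
    @T1Space (BCA.Grz A)
      (TopologicalSpace.generateFrom
        {s : Set (BCA.Grz A) | ∃ x : B, s = {G | x ∈ G.1}}) := by
  let _ : TopologicalSpace (BCA.Grz A) := TopologicalSpace.generateFrom
    {s : Set (BCA.Grz A) | ∃ x : B, s = {G | x ∈ G.1}}
  refine t1Space_iff_exists_open.2 fun G H hGH => ?_
  have hnot : ¬ G.1 ⊆ H.1 := fun h => hGH (Subtype.ext (G.2.eq_of_subset H.2 h))
  obtain ⟨x, hxG, hxH⟩ := Set.not_subset.1 hnot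
  exact ⟨{K | x ∈ K.1}, TopologicalSpace.isOpen_generateFrom_of_mem ⟨x, rfl⟩, hxG, hxH⟩
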